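/- Assume σ is a d-dimensional simplicial cone, i.e. n = d and v_1, …, v_d are linearly independent. Let m be the maximal monomial ideal of R (generated by all monomials X^u with u ∈ (σ^∨ ∩ ℤ^d) \ {0}), let J be an m-primary monomial ideal of R (√J = m), and let a be a proper nonzero monomial ideal of R. Then the F-threshold c^J(a) = lim_{e→∞} ν_a^J(p^e)/p^e is a rational number. -/

import Mathlib

open Finset Filter Pointwise

noncomputable section

namespace Paper

variable {d n : ℕ}

/-- The standard inner product pairing on `ℝ^d`. -/
def pair (u w : Fin d → ℝ) : ℝ := ∑ i, u i * w i

/-- The coercion `ℤ^d → ℝ^d`. -/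
def toR (u : Fin d → ℤ) : Fin d → ℝ := fun i => (u i : ℝ)

/-- The cone generated by the integer vectors `v 1, …, v n`. -/
def cone (v : Fin n → Fin d → ℤ) : Set (Fin d → ℝ) :=
  {x | ∃ c : Fin n → ℝ, (∀ j, 0 ≤ c j) ∧ x = ∑ j, c j • toR (v j)}

/-- The dual cone `σ^∨ = {u | ⟨u, x⟩ ≥ 0 for all x ∈ σ}`. -/
def dualCone (v : Fin n → Fin d → ℤ) : Set (Fin d → ℝ) :=
  {u | ∀ x ∈ cone v, 0 ≤ pair u x}

/-- Strong convexity of the cone generated by `v`. -/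
def StronglyConvex (v : Fin n → Fin d → ℤ) : Prop :=
  ∀ x ∈ cone v, -x ∈ cone v → x = 0

/-- An integer vector is primitive if the gcd of its coordinates is 1. -/
def IsPrimitive (w : Fin d → ℤ) : Prop := Finset.univ.gcd w = 1

/-- The cone generated by `v` is `d`-dimensional. -/
def FullDim (v : Fin n → Fin d → ℤ) : Prop :=
  Submodule.span ℝ (Set.range fun j => toR (v j)) = ⊤

/-- The Newton polyhedron `P(A) = conv(A) + σ^∨`. -/
def newton (v : Fin n → Fin d → ℤ) (A : Finset (Fin d → ℤ)) : Set (Fin d → ℝ) :=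
  convexHull ℝ (toR '' ↑A) + dualCone v

/-- The set `Q(A) = ⋃_{a ∈ A} (a + σ^∨)`. -/
def QSet (v : Fin n → Fin d → ℤ) (A : Finset (Fin d → ℤ)) : Set (Fin d → ℝ) :=
  ⋃ a ∈ A, (toR a +ᵥ dualCone v)

/-- `λ_A(u) = sup {λ > 0 | u ∈ λ·P(A)}` (and `0` if no such `λ` exists;
note `Real.sSup` of the empty set is `0`). -/
def lam (v : Fin n → Fin d → ℤ) (A : Finset (Fin d → ℤ)) (u : Fin d → ℝ) : ℝ :=
  sSup {l : ℝ | 0 < l ∧ u ∈ l • newton v A}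

/-- `Q(m)` for the maximal monomial ideal, whose exponent set is
`(σ^∨ ∩ ℤ^d) \ {0}`. -/
def Qm (v : Fin n → Fin d → ℤ) : Set (Fin d → ℝ) :=
  ⋃ a ∈ {a : Fin d → ℤ | toR a ∈ dualCone v ∧ a ≠ 0}, (toR a +ᵥ dualCone v)

/-- The set `O = {u ∈ σ^∨ | ⟨u, v_j⟩ ≥ 1 for some j}`. -/
def OSet (v : Fin n → Fin d → ℤ) : Set (Fin d → ℝ) :=
  {u ∈ dualCone v | ∃ j, 1 ≤ pair u (toR (v j))}

/-- The additive submonoid `σ^∨ ∩ ℤ^d` of `ℤ^d`. -/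
def latt (v : Fin n → Fin d → ℤ) : AddSubmonoid (Fin d → ℤ) where
  carrier := {u | toR u ∈ dualCone v}
  zero_mem' := by
    intro x hx
    simp [pair, toR]
  add_mem' := by
    intro a b ha hb x hx
    have h : pair (toR (a + b)) x = pair (toR a) x + pair (toR b) x := by
      simp [pair, toR, add_mul, Finset.sum_add_distrib]
    have h2 := add_nonneg (ha x hx) (hb x hx)
    rw [h]
    exact h2

/-- The toric ring `R = k[σ^∨ ∩ ℤ^d]`, as the monoid algebra of the
additive monoid `σ^∨ ∩ ℤ^d` over `k`. -/
abbrev Toric (k : Type) [Field k] (v : Fin n → Fin d → ℤ) : Type :=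
  AddMonoidAlgebra k (latt v)

/-- The monomial ideal of `R` with exponent set `A`: the ideal generated by
the monomials `X^a`, `a ∈ A`. -/
def monIdeal (k : Type) [Field k] (v : Fin n → Fin d → ℤ) (A : Finset (Fin d → ℤ)) :
    Ideal (Toric k v) :=
  Ideal.span {x | ∃ a : latt v, (a : Fin d → ℤ) ∈ A ∧ x = AddMonoidAlgebra.single a 1}

/-- The maximal monomial ideal of `R`, generated by all monomials `X^u`
with `u ∈ (σ^∨ ∩ ℤ^d) \ {0}`. -/
def maxMonIdeal (k : Type) [Field k] (v : Fin n → Fin d → ℤ) : Ideal (Toric k v) :=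
  Ideal.span {x | ∃ a : latt v, a ≠ 0 ∧ x = AddMonoidAlgebra.single a 1}

/-- The bracket power `J^{[q]}`: the ideal generated by the `q`-th powers of
elements of `J`. -/
def bracket {S : Type*} [CommRing S] (J : Ideal S) (q : ℕ) : Ideal S :=
  Ideal.span ((fun x => x ^ q) '' (J : Set S))

/-- `ν_a^J(q) = max {r ∈ ℕ | a^r ⊄ J^{[q]}}`. -/
def nuF {S : Type*} [CommRing S] (a J : Ideal S) (q : ℕ) : ℕ :=
  sSup {r : ℕ | ¬ a ^ r ≤ bracket J q}


lemma exists_qlin (t : ℝ) (ht : ∀ c : ℚ, t ≠ c) : ∃ φ : ℝ →ₗ[ℚ] ℝ, φ 1 = 0 ∧ φ t = 1 := by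
  have h : t ∉ Submodule.span ℚ {(1:ℝ)} := by
    rw [Submodule.mem_span_singleton]
    rintro ⟨a, ha⟩
    exact ht a (by rw [← ha, Rat.smul_def, mul_one])
  obtain ⟨f, hf, hf2⟩ := Submodule.exists_le_ker_of_notMem h
  have h1 : f 1 = 0 := by
    have := hf2 (Submodule.mem_span_singleton_self (R := ℚ) (1:ℝ))
    simpa using this
  refine ⟨(LinearMap.toSpanSingleton ℚ ℝ (((f t)⁻¹ : ℚ) : ℝ)).comp f, by simp [h1], ?_⟩
  simp only [LinearMap.comp_apply, LinearMap.toSpanSingleton_apply, Rat.smul_def]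
  norm_cast
  exact mul_inv_cancel₀ hf

lemma core {ι κ : Type} [Fintype ι] [Fintype κ] {d : ℕ} (D : ι → Fin d → ℤ) (E : κ → Fin d → ℤ)
    (hD : ∀ a j, 0 ≤ D a j) (hD' : ∀ a, ∃ j, 0 < D a j) (hE' : ∀ b, ∃ j, 0 < E b j)
    (hr : ∀ j, ∃ b, ∀ i, i ≠ j → E b i ≤ 0) :
    ∃ c : ℚ, Tendsto (fun q : ℕ => ((sSup {r : ℕ | ∃ n : ι → ℕ, ∑ a, n a = r ∧
      ∀ b, ∃ j, ∑ a, (n a : ℤ) * D a j < q * E b j} : ℕ) : ℝ) / (q : ℝ)) atTop (nhds (c : ℝ)) := by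
  set S : Set (ι → ℝ) := {x | (∀ a, 0 ≤ x a) ∧
    ∀ b, ∃ j, 0 < E b j ∧ ∑ a, x a * D a j ≤ E b j} with hS
  have hcl : IsClosed S := by
    have : S = (⋂ a, {x | 0 ≤ x a}) ∩ ⋂ b, ⋃ j, {x | 0 < E b j ∧ ∑ a, x a * (D a j:ℝ) ≤ E b j} := by
      ext x; simp [hS]
    rw [this]
    refine (isClosed_iInter fun a => isClosed_le continuous_const (continuous_apply a)).inter
      (isClosed_iInter fun b => isClosed_iUnion_of_finite fun j => ?_)
    by_cases h : 0 < E b j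
    · simp only [h, true_and]
      exact isClosed_le (by fun_prop) continuous_const
    · simp [h]
  have hbd : ∃ K : ℝ, ∀ x ∈ S, ∀ a, x a ≤ K := by
    refine ⟨∑ b, ∑ j, |(E b j : ℝ)|, fun x hx a => ?_⟩
    obtain ⟨j, hj⟩ := hD' a
    obtain ⟨b, hb⟩ := hr j
    obtain ⟨i, hi, hi2⟩ := hx.2 b
    have : i = j := by
      by_contra hne
      exact absurd (hb i hne) (not_le.2 hi)
    subst this
    have h1 : x a ≤ x a * D a i := by
      have : (1:ℝ) ≤ D a i := by exact_mod_cast hj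
      nlinarith [hx.1 a]
    have h2 : x a * D a i ≤ ∑ a, x a * D a i :=
      Finset.single_le_sum (f := fun a => x a * (D a i : ℝ))
        (fun a _ => mul_nonneg (hx.1 a) (by exact_mod_cast hD a i)) (mem_univ a)
    have h3 : |(E b i : ℝ)| ≤ ∑ j, |(E b j : ℝ)| :=
      Finset.single_le_sum (f := fun j => |(E b j : ℝ)|) (fun _ _ => abs_nonneg _) (mem_univ i)
    have h4 : ∑ j, |(E b j : ℝ)| ≤ ∑ b, ∑ j, |(E b j : ℝ)| :=
      Finset.single_le_sum (f := fun b => ∑ j, |(E b j : ℝ)|)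
        (fun _ _ => Finset.sum_nonneg fun _ _ => abs_nonneg _) (mem_univ b)
    linarith [le_abs_self (E b i : ℝ)]
  obtain ⟨K, hK⟩ := hbd
  have hcpt : IsCompact S := by
    refine IsCompact.of_isClosed_subset (isCompact_univ_pi (s := fun _ : ι => Set.Icc (0:ℝ) K)
      fun _ => isCompact_Icc) hcl ?_
    intro x hx a _
    exact ⟨hx.1 a, hK x hx a⟩
  have hne : S.Nonempty := by
    refine ⟨0, fun a => le_rfl, fun b => ?_⟩
    obtain ⟨j, hj⟩ := hE' b
    exact ⟨j, hj, by simpa using hj.le⟩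
  obtain ⟨x, hx, hmax⟩ := hcpt.exists_isMaxOn hne
    (f := fun x => ∑ a, x a) (by fun_prop)
  have hmax : ∀ y ∈ S, ∑ a, y a ≤ ∑ a, x a := fun y hy => hmax hy
  set t : ℝ := ∑ a, x a with htdef
  have hrat : ∃ c : ℚ, t = c := by
    by_contra! hno
    obtain ⟨φ, h1, h2⟩ := exists_qlin t hno
    have hφ : ∀ m : ℤ, φ m = 0 := fun m => by
      have := φ.map_smul (m : ℚ) 1
      simpa [Rat.smul_def, h1] using this
    have hφm : ∀ (y : ℝ) (m : ℤ), φ (y * m) = φ y * m := fun y m => by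
      have := φ.map_smul (m : ℚ) y
      simp only [Rat.smul_def, Rat.cast_intCast] at this
      rw [mul_comm, this, mul_comm]
    choose J hJ hJ2 using hx.2
    have key : ∀ u w : ℝ, u ≤ w → (u = w → φ u = φ w) →
        ∀ᶠ ε : ℝ in nhdsWithin 0 (Set.Ioi 0), u + ε * φ u ≤ w + ε * φ w := by
      intro u w huw he
      rcases huw.eq_or_lt with h | h
      · rw [h]; simp
      · have c1 : ContinuousAt (fun ε : ℝ => u + ε * φ u) 0 := by fun_prop
        have c2 : ContinuousAt (fun ε : ℝ => w + ε * φ w) 0 := by fun_prop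
        have := c1.eventually_lt c2 (by simpa using h)
        exact (this.filter_mono nhdsWithin_le_nhds).mono fun _ h => h.le
    have e1 : ∀ᶠ ε : ℝ in nhdsWithin 0 (Set.Ioi 0), ∀ a, 0 ≤ x a + ε * φ (x a) := by
      rw [eventually_all]
      intro a
      have := key 0 (x a) (hx.1 a) (fun h => by rw [h])
      simpa using this
    have e2 : ∀ᶠ ε : ℝ in nhdsWithin 0 (Set.Ioi 0), ∀ b,
        ∑ a, (x a + ε * φ (x a)) * D a (J b) ≤ E b (J b) := by
      rw [eventually_all]
      intro b
      have := key _ _ (hJ2 b) (fun h => by rw [h])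
      refine this.mono fun ε h => ?_
      rw [hφ, map_sum] at h
      simp only [hφm, mul_zero, add_zero] at h
      refine le_trans (le_of_eq ?_) h
      rw [Finset.mul_sum, ← Finset.sum_add_distrib]
      exact Finset.sum_congr rfl fun a _ => by ring
    obtain ⟨ε, ⟨h3, h4⟩, h5⟩ := ((e1.and e2).and self_mem_nhdsWithin).exists
    have h6 := hmax (fun a => x a + ε * φ (x a)) ⟨h3, fun b => ⟨J b, hJ b, h4 b⟩⟩
    rw [Finset.sum_add_distrib, ← Finset.mul_sum, ← map_sum, ← htdef, h2] at h6
    have : 0 < ε := h5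
    linarith
  obtain ⟨c, hc⟩ := hrat
  refine ⟨c, ?_⟩
  rw [← hc]
  have hup : ∀ q : ℕ, 1 ≤ q → ∀ r ∈ {r : ℕ | ∃ n : ι → ℕ, ∑ a, n a = r ∧
      ∀ b, ∃ j, ∑ a, (n a : ℤ) * D a j < q * E b j}, (r : ℝ) ≤ q * t := by
    rintro q hq r ⟨n, rfl, hn⟩
    have hq0 : (0:ℝ) < q := by exact_mod_cast hq
    have := hmax (fun a => n a / q) ⟨fun a => by positivity, fun b => ?_⟩
    · rw [← Finset.sum_div, div_le_iff₀ hq0] at this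
      push_cast
      linarith
    · obtain ⟨j, hj⟩ := hn b
      have h0 : 0 ≤ ∑ a, (n a : ℤ) * D a j :=
        Finset.sum_nonneg fun a _ => mul_nonneg (by positivity) (hD a j)
      refine ⟨j, ?_, ?_⟩
      · have : (0:ℤ) < q * E b j := lt_of_le_of_lt h0 hj
        exact pos_of_mul_pos_right this (by positivity)
      · have hj' : ∑ a, (n a : ℝ) * D a j < q * E b j := by exact_mod_cast hj
        have : ∑ a, (n a : ℝ) / q * D a j = (∑ a, (n a : ℝ) * D a j) / q := by
          rw [Finset.sum_div]; exact Finset.sum_congr rfl fun a _ => by ring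
        rw [this, div_le_iff₀ hq0]
        linarith
  have hlow : ∀ q : ℕ, 1 ≤ q → (∑ a, ⌊((q:ℝ) - 1) * x a⌋₊) ∈ {r : ℕ | ∃ n : ι → ℕ, ∑ a, n a = r ∧
      ∀ b, ∃ j, ∑ a, (n a : ℤ) * D a j < q * E b j} := by
    intro q hq
    have hq1 : (0:ℝ) ≤ q - 1 := by
      have : (1:ℝ) ≤ q := by exact_mod_cast hq
      linarith
    refine ⟨_, rfl, fun b => ?_⟩
    obtain ⟨j, hj, hj2⟩ := hx.2 b
    refine ⟨j, ?_⟩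
    have : ∑ a, (⌊((q:ℝ) - 1) * x a⌋₊ : ℝ) * D a j < q * E b j := by
      have h1 : ∑ a, (⌊((q:ℝ) - 1) * x a⌋₊ : ℝ) * D a j ≤ ∑ a, (((q:ℝ) - 1) * x a) * D a j :=
        Finset.sum_le_sum fun a _ => mul_le_mul_of_nonneg_right
          (Nat.floor_le (mul_nonneg hq1 (hx.1 a))) (by exact_mod_cast hD a j)
      have h2 : ∑ a, (((q:ℝ) - 1) * x a) * D a j = (q - 1) * ∑ a, x a * D a j := by
        rw [Finset.mul_sum]; exact Finset.sum_congr rfl fun a _ => by ring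
      have h3 : (0:ℝ) < E b j := by exact_mod_cast hj
      have h4 := mul_le_mul_of_nonneg_left hj2 hq1
      linarith
    exact_mod_cast this
  have hlim : Tendsto (fun q : ℕ => t - (t + Fintype.card ι) / (q:ℝ)) atTop (nhds t) := by
    have := (tendsto_const_div_atTop_nhds_zero_nat (t + Fintype.card ι)).const_sub t
    simpa using this
  refine tendsto_of_tendsto_of_tendsto_of_le_of_le' hlim tendsto_const_nhds ?_ ?_
  · filter_upwards [eventually_ge_atTop 1] with q hq
    have hq0 : (0:ℝ) < q := by exact_mod_cast hq
    have hb : BddAbove {r : ℕ | ∃ n : ι → ℕ, ∑ a, n a = r ∧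
      ∀ b, ∃ j, ∑ a, (n a : ℤ) * D a j < q * E b j} :=
      ⟨⌊q * t⌋₊, fun r hr => Nat.le_floor (hup q hq r hr)⟩
    have h1 := le_csSup hb (hlow q hq)
    have h2 : ((∑ a, ⌊((q:ℝ) - 1) * x a⌋₊ : ℕ) : ℝ) ≤ _ := Nat.cast_le.2 h1
    have h3 : (q - 1) * t - Fintype.card ι ≤ ((∑ a, ⌊((q:ℝ) - 1) * x a⌋₊ : ℕ) : ℝ) := by
      push_cast
      have : ∑ a, (((q:ℝ) - 1) * x a - 1) ≤ ∑ a, (⌊((q:ℝ) - 1) * x a⌋₊ : ℝ) :=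
        Finset.sum_le_sum fun a _ => (Nat.sub_one_lt_floor _).le
      rw [Finset.sum_sub_distrib, ← Finset.mul_sum] at this
      simpa using this
    rw [le_div_iff₀ hq0, sub_mul, div_mul_cancel₀ _ hq0.ne']
    linarith
  · filter_upwards [eventually_ge_atTop 1] with q hq
    have hq0 : (0:ℝ) < q := by exact_mod_cast hq
    have hb : BddAbove {r : ℕ | ∃ n : ι → ℕ, ∑ a, n a = r ∧
      ∀ b, ∃ j, ∑ a, (n a : ℤ) * D a j < q * E b j} :=
      ⟨⌊q * t⌋₊, fun r hr => Nat.le_floor (hup q hq r hr)⟩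
    have := hup q hq _ (Nat.sSup_mem ⟨_, hlow q hq⟩ hb)
    rw [div_le_iff₀ hq0]
    linarith

section helpers

lemma mem_span_mono {k : Type} [Field k] {v : Fin n → Fin d → ℤ} (P : latt v → Prop) (w : latt v) :
    (AddMonoidAlgebra.single w 1 : Toric k v) ∈
      Ideal.span {x : Toric k v | ∃ a : latt v, P a ∧ x = AddMonoidAlgebra.single a 1} ↔
    ∃ a, P a ∧ ∃ c, w = c + a := by
  have h : {x : Toric k v | ∃ a : latt v, P a ∧ x = AddMonoidAlgebra.single a 1} =
      AddMonoidAlgebra.of' k (latt v) '' {a | P a} := by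
    ext x
    simp only [Set.mem_ofPred_eq, Set.mem_image, AddMonoidAlgebra.of'_apply]
    exact exists_congr fun a => and_congr_right fun _ => eq_comm
  rw [h, AddMonoidAlgebra.mem_ideal_span_of'_image]
  constructor
  · intro H
    exact H w (by simp)
  · intro H m hm
    have : m = w := by
      by_contra hne
      rw [Finsupp.mem_support_iff] at hm
      exact hm (Finsupp.single_eq_of_ne hne)
    rw [this]
    exact H

/-- The integer pairing. -/
def pr (v : Fin n → Fin d → ℤ) (u : Fin d → ℤ) (j : Fin n) : ℤ := ∑ i, u i * v j i

lemma pr_add (v : Fin n → Fin d → ℤ) (u w : Fin d → ℤ) (j : Fin n) :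
    pr v (u + w) j = pr v u j + pr v w j := by
  simp [pr, add_mul, Finset.sum_add_distrib]

lemma pr_zero (v : Fin n → Fin d → ℤ) (j : Fin n) : pr v 0 j = 0 := by
  simp [pr]

lemma pr_sub (v : Fin n → Fin d → ℤ) (u w : Fin d → ℤ) (j : Fin n) :
    pr v (u - w) j = pr v u j - pr v w j := by
  simp [pr, sub_mul, Finset.sum_sub_distrib]

lemma pr_nsmul (v : Fin n → Fin d → ℤ) (m : ℕ) (u : Fin d → ℤ) (j : Fin n) :
    pr v (m • u) j = m * pr v u j := by
  simp [pr, Finset.mul_sum, mul_assoc]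

lemma pr_sum (v : Fin n → Fin d → ℤ) {ι : Type*} (s : Finset ι) (f : ι → Fin d → ℤ) (j : Fin n) :
    pr v (∑ a ∈ s, f a) j = ∑ a ∈ s, pr v (f a) j := by
  classical
  induction s using Finset.induction_on with
  | empty => simp [pr_zero]
  | insert a s ha ih => rw [Finset.sum_insert ha, Finset.sum_insert ha, pr_add, ih]

lemma pair_toR (v : Fin n → Fin d → ℤ) (u : Fin d → ℤ) (j : Fin n) :
    pair (toR u) (toR (v j)) = (pr v u j : ℝ) := by
  simp [pair, toR, pr]

lemma mem_dual (v : Fin n → Fin d → ℤ) (u : Fin d → ℤ) :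
    toR u ∈ dualCone v ↔ ∀ j, 0 ≤ pr v u j := by
  classical
  constructor
  · intro h j
    have := h (toR (v j)) ⟨Pi.single j 1, fun i => ?_, ?_⟩
    · rw [pair_toR] at this
      exact_mod_cast this
    · by_cases hij : i = j
      · subst hij; simp
      · simp [hij]
    · simp [Pi.single_apply, ite_smul]
  · rintro h x ⟨c, hc, rfl⟩
    have : pair (toR u) (∑ j, c j • toR (v j)) = ∑ j, c j * pair (toR u) (toR (v j)) := by
      simp only [pair, Finset.sum_apply, Pi.smul_apply, smul_eq_mul, Finset.mul_sum]
      rw [Finset.sum_comm]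
      exact Finset.sum_congr rfl fun _ _ => Finset.sum_congr rfl fun _ _ => by ring
    rw [this]
    refine Finset.sum_nonneg fun j _ => mul_nonneg (hc j) ?_
    rw [pair_toR]
    exact_mod_cast h j

lemma latt_pr {v : Fin n → Fin d → ℤ} (u : latt v) (j : Fin n) : 0 ≤ pr v u j :=
  (mem_dual v u).1 u.2 j

lemma pr_inj {v : Fin d → Fin d → ℤ} (hli : LinearIndependent ℝ fun j => toR (v j))
    {u : Fin d → ℤ} (hu : ∀ j, pr v u j = 0) : u = 0 := by
  have hunit : IsUnit (Matrix.of fun j => toR (v j)) :=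
    Matrix.linearIndependent_rows_iff_isUnit.1 hli
  have h : (Matrix.of fun j => toR (v j)).mulVec (toR u) = 0 := by
    ext j
    have := pair_toR v u j
    rw [hu j] at this
    simp only [Matrix.mulVec, dotProduct, Matrix.of_apply, Pi.zero_apply]
    simp only [pair, Int.cast_zero] at this
    rw [← this]
    exact Finset.sum_congr rfl fun _ _ => mul_comm _ _
  have h2 := Matrix.mulVec_injective_iff_isUnit.2 hunit (h.trans (Matrix.mulVec_zero _).symm)
  ext i
  have := congrFun h2 i
  simpa [toR] using this

lemma exists_ray {v : Fin d → Fin d → ℤ} (hli : LinearIndependent ℝ fun j => toR (v j))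
    (j : Fin d) : ∃ u : latt v, u ≠ 0 ∧ ∀ i, i ≠ j → pr v u i = 0 := by
  classical
  set M : Matrix (Fin d) (Fin d) ℤ := Matrix.of v with hM
  have hdet : M.det ≠ 0 := by
    have hunit : IsUnit (Matrix.of fun j => toR (v j)) :=
      Matrix.linearIndependent_rows_iff_isUnit.1 hli
    have h1 : (Matrix.of fun j => toR (v j)) = M.map (Int.castRingHom ℝ) := by
      ext a b; simp [hM, toR]
    rw [h1, Matrix.isUnit_iff_isUnit_det, ← RingHom.mapMatrix_apply, ← RingHom.map_det] at hunit
    intro h0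
    rw [h0] at hunit
    simp at hunit
  set u : Fin d → ℤ := fun i => M.det * M.adjugate i j with hu
  have hpr : ∀ i, pr v u i = if i = j then M.det * M.det else 0 := by
    intro i
    have h := congrFun (congrFun (Matrix.mul_adjugate M) i) j
    rw [Matrix.mul_apply, Matrix.smul_apply, Matrix.one_apply] at h
    have h2 : pr v u i = M.det * ∑ l, M i l * M.adjugate l j := by
      rw [pr, Finset.mul_sum]
      exact Finset.sum_congr rfl fun l _ => by simp only [hu, hM, Matrix.of_apply]; ring
    rw [h2, h]
    split_ifs <;> simp
  refine ⟨⟨u, (mem_dual v u).2 fun i => ?_⟩, fun h0 => ?_, fun i hi => ?_⟩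
  · rw [hpr]; split_ifs
    · exact mul_self_nonneg _
    · exact le_rfl
  · have h1 : u = 0 := congrArg Subtype.val h0
    have h2 := hpr j
    rw [h1, pr_zero] at h2
    simp at h2
    exact hdet h2
  · show pr v u i = 0
    rw [hpr]; simp [hi]

lemma bracket_eq {k : Type} [Field k] {p : ℕ} (hp : p.Prime) [CharP k p] (v : Fin n → Fin d → ℤ)
    (B : Finset (Fin d → ℤ)) (e : ℕ) :
    bracket (monIdeal k v B) (p ^ e) =
      Ideal.span {x : Toric k v | ∃ c : latt v, (∃ b : latt v, (b : Fin d → ℤ) ∈ B ∧ c = p ^ e • b)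
        ∧ x = AddMonoidAlgebra.single c 1} := by
  have : Fact p.Prime := ⟨hp⟩
  have : CharP (Toric k v) p := charP_of_injective_algebraMap (algebraMap k (Toric k v)).injective p
  apply le_antisymm
  · rw [bracket, Ideal.span_le]
    rintro _ ⟨x, hx, rfl⟩
    have hle : monIdeal k v B ≤ Ideal.comap (iterateFrobenius (Toric k v) p e) (Ideal.span
      {x : Toric k v | ∃ c : latt v, (∃ b : latt v, (b : Fin d → ℤ) ∈ B ∧ c = p ^ e • b)
        ∧ x = AddMonoidAlgebra.single c 1}) := by
      rw [monIdeal, Ideal.span_le]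
      rintro _ ⟨b, hb, rfl⟩
      rw [SetLike.mem_coe, Ideal.mem_comap, iterateFrobenius_def, AddMonoidAlgebra.single_pow,
        one_pow]
      exact Ideal.subset_span ⟨_, ⟨b, hb, rfl⟩, rfl⟩
    have := hle hx
    rwa [Ideal.mem_comap, iterateFrobenius_def] at this
  · rw [Ideal.span_le]
    rintro _ ⟨_, ⟨b, hb, rfl⟩, rfl⟩
    refine Ideal.subset_span ⟨AddMonoidAlgebra.single b 1, Ideal.subset_span ⟨b, hb, rfl⟩, ?_⟩
    simp [AddMonoidAlgebra.single_pow]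

lemma mem_pow_set {k : Type} [Field k] {v : Fin n → Fin d → ℤ} {A : Finset (Fin d → ℤ)}
    (hAl : ∀ a ∈ A, a ∈ latt v) (r : ℕ) (y : Toric k v) :
    y ∈ ({x : Toric k v | ∃ a : latt v, (a : Fin d → ℤ) ∈ A ∧ x = AddMonoidAlgebra.single a 1} ^ r :
      Set (Toric k v)) ↔
    ∃ m : A → ℕ, ∑ a, m a = r ∧
      y = AddMonoidAlgebra.single (∑ a : A, m a • (⟨a.1, hAl a.1 a.2⟩ : latt v)) 1 := by
  classical
  induction r generalizing y with
  | zero =>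
    rw [pow_zero, Set.mem_one]
    constructor
    · rintro rfl
      exact ⟨0, by simp, by simp [AddMonoidAlgebra.one_def]⟩
    · rintro ⟨m, hm, rfl⟩
      have : ∀ a, m a = 0 := by simpa using hm
      simp [this, AddMonoidAlgebra.one_def]
  | succ r ih =>
    rw [pow_succ, Set.mem_mul]
    constructor
    · rintro ⟨x, hx, _, ⟨a, ha, rfl⟩, rfl⟩
      obtain ⟨m, hm, rfl⟩ := (ih x).1 hx
      refine ⟨m + Pi.single ⟨a, ha⟩ 1, ?_, ?_⟩
      · simp only [Pi.add_apply, Finset.sum_add_distrib, Finset.sum_pi_single', mem_univ,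
          if_true, hm]
      · rw [AddMonoidAlgebra.single_mul_single, one_mul]
        congr 1
        simp [add_smul, Finset.sum_add_distrib, Pi.single_apply, ite_smul]
    · rintro ⟨m, hm, rfl⟩
      have : ∃ a, m a ≠ 0 := by
        by_contra! h
        simp [h] at hm
      obtain ⟨a, ha⟩ := this
      have hm' : m = (m - Pi.single a 1) + Pi.single a 1 := by
        ext b
        by_cases hb : b = a
        · subst hb; simp; omega
        · simp [hb]
      have hs : ∑ b, (m - (Pi.single a 1 : A → ℕ)) b = r := by
        rw [hm'] at hm
        simp only [Pi.add_apply, Finset.sum_add_distrib, Finset.sum_pi_single', mem_univ,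
          if_true] at hm
        omega
      refine ⟨_, (ih _).2 ⟨m - Pi.single a 1, hs, rfl⟩,
        AddMonoidAlgebra.single ⟨a.1, hAl a.1 a.2⟩ 1, ⟨_, a.2, rfl⟩, ?_⟩
      rw [AddMonoidAlgebra.single_mul_single, one_mul]
      congr 1
      conv_rhs => rw [hm']
      simp [-add_tsub_cancel_right, add_smul, Finset.sum_add_distrib, Pi.single_apply, ite_smul]

lemma nu_set {k : Type} [Field k] {p : ℕ} (hp : p.Prime) [CharP k p] {v : Fin n → Fin d → ℤ}
    {A B : Finset (Fin d → ℤ)}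
    (hAl : ∀ a ∈ A, a ∈ latt v) (hBl : ∀ b ∈ B, b ∈ latt v) (e : ℕ) :
    {r : ℕ | ¬ (monIdeal k v A) ^ r ≤ bracket (monIdeal k v B) (p ^ e)} =
    {r : ℕ | ∃ m : A → ℕ, ∑ a, m a = r ∧
      ∀ b : B, ∃ j, ∑ a : A, (m a : ℤ) * pr v a.1 j < ((p ^ e : ℕ) : ℤ) * pr v b.1 j} := by
  ext r
  have hsum : ∀ (m : A → ℕ) j, pr v
      ((∑ a : A, m a • (⟨a.1, hAl a.1 a.2⟩ : latt v) : latt v) : Fin d → ℤ) j =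
      ∑ a : A, (m a : ℤ) * pr v a.1 j := by
    intro m j
    rw [AddSubmonoid.coe_finsetSum, pr_sum]
    exact Finset.sum_congr rfl fun a _ => by
      rw [AddSubmonoidClass.coe_nsmul, pr_nsmul]
  have hmem : ∀ w : latt v, (AddMonoidAlgebra.single w 1 : Toric k v) ∈
      bracket (monIdeal k v B) (p ^ e) ↔
      ∃ b : B, ∀ j, ((p ^ e : ℕ) : ℤ) * pr v b.1 j ≤ pr v w j := by
    intro w
    rw [bracket_eq hp, mem_span_mono]
    constructor
    · rintro ⟨_, ⟨b, hb, rfl⟩, c, rfl⟩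
      refine ⟨⟨b, hb⟩, fun j => ?_⟩
      rw [AddSubmonoid.coe_add, pr_add, AddSubmonoidClass.coe_nsmul, pr_nsmul]
      linarith [latt_pr c j]
    · rintro ⟨b, hb⟩
      refine ⟨_, ⟨⟨b.1, hBl b.1 b.2⟩, b.2, rfl⟩,
        ⟨(w : Fin d → ℤ) - p ^ e • b.1, (mem_dual _ _).2 fun j => ?_⟩, ?_⟩
      · rw [pr_sub, pr_nsmul]
        linarith [hb j]
      · ext1
        simp
  simp only [Set.mem_ofPred_eq]
  rw [monIdeal, Ideal.span, Submodule.span_pow, Submodule.span_le, Set.not_subset]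
  constructor
  · rintro ⟨y, hy, hy2⟩
    obtain ⟨m, hm, rfl⟩ := (mem_pow_set hAl r y).1 hy
    refine ⟨m, hm, ?_⟩
    rw [SetLike.mem_coe, hmem] at hy2
    push Not at hy2
    simpa only [hsum] using hy2
  · rintro ⟨m, hm, h⟩
    refine ⟨_, (mem_pow_set hAl r _).2 ⟨m, hm, rfl⟩, ?_⟩
    rw [SetLike.mem_coe, hmem]
    push Not
    simpa only [hsum] using h

end helpers

/-- for `σ` a `d`-dimensional simplicial cone, the F-threshold
`c^J(a)` of a proper nonzero monomial ideal `a` with respect to an `m`-primary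
monomial ideal `J` exists and is a rational number. -/
theorem fthreshold_rational
    (d p : ℕ) (hd : 1 ≤ d) (hp : p.Prime)
    (k : Type) [Field k] [CharP k p] [ExpChar k p] [PerfectRing k p]
    (v : Fin d → Fin d → ℤ)
    (hsc : StronglyConvex v) (hprim : ∀ j, IsPrimitive (v j))
    (hli : LinearIndependent ℝ fun j => toR (v j))
    (A B : Finset (Fin d → ℤ))
    (hAne : A.Nonempty) (hBne : B.Nonempty)
    (hAl : ∀ a ∈ A, toR a ∈ dualCone v) (hBl : ∀ b ∈ B, toR b ∈ dualCone v)
    (ha0 : monIdeal k v A ≠ ⊥) (haP : monIdeal k v A ≠ ⊤)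
    (hJprimary : (monIdeal k v B).radical = maxMonIdeal k v) :
    ∃ c : ℚ,
      Filter.Tendsto
        (fun e : ℕ => (nuF (monIdeal k v A) (monIdeal k v B) (p ^ e) : ℝ) / (p ^ e : ℝ))
        Filter.atTop (nhds (c : ℝ)) := by
  have hpos : ∀ u : Fin d → ℤ, toR u ∈ dualCone v → u ≠ 0 → ∃ j, 0 < pr v u j := by
    intro u hu hne
    by_contra! h
    exact hne (pr_inj hli fun j => le_antisymm (h j) ((mem_dual v u).1 hu j))
  have htop : ∀ (T : Finset (Fin d → ℤ)), (0 : Fin d → ℤ) ∈ T → monIdeal k v T = ⊤ := by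
    intro T hT
    rw [Ideal.eq_top_iff_one, AddMonoidAlgebra.one_def]
    exact Ideal.subset_span ⟨0, hT, rfl⟩
  have hA0 : ∀ a : A, ∃ j, 0 < pr v a.1 j := fun a =>
    hpos a.1 (hAl a.1 a.2) fun h => haP (htop A (h ▸ a.2))
  have hB0 : ∀ b : B, ∃ j, 0 < pr v b.1 j := fun b =>
    hpos b.1 (hBl b.1 b.2) fun h => by
      have h1 := htop B (h ▸ b.2)
      rw [h1, Ideal.radical_top] at hJprimary
      have h2 : (AddMonoidAlgebra.single 0 1 : Toric k v) ∈ maxMonIdeal k v := by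
        rw [← hJprimary]; trivial
      obtain ⟨a, ha, c, hc⟩ := (mem_span_mono (k := k) (fun a : latt v => a ≠ 0) 0).1 h2
      apply ha
      have h3 : (a : Fin d → ℤ) = 0 := pr_inj hli fun j => by
        have h4 : pr v ((c + a : latt v) : Fin d → ℤ) j = 0 := by
          rw [← hc]; exact pr_zero v j
        rw [AddSubmonoid.coe_add, pr_add] at h4
        linarith [latt_pr a j, latt_pr c j]
      exact Subtype.ext h3
  have hray : ∀ j, ∃ b : B, ∀ i, i ≠ j → pr v b.1 i ≤ 0 := by
    intro j
    obtain ⟨u, hu, hu2⟩ := exists_ray hli j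
    have h1 : (AddMonoidAlgebra.single u 1 : Toric k v) ∈ (monIdeal k v B).radical := by
      rw [hJprimary]
      exact Ideal.subset_span ⟨u, hu, rfl⟩
    obtain ⟨N, hN⟩ := h1
    rw [AddMonoidAlgebra.single_pow, one_pow] at hN
    obtain ⟨b, hb, c, hc⟩ :=
      (mem_span_mono (k := k) (fun a : latt v => (a : Fin d → ℤ) ∈ B) (N • u)).1 hN
    refine ⟨⟨b, hb⟩, fun i hi => ?_⟩
    have h4 : pr v ((c + b : latt v) : Fin d → ℤ) i = 0 := by
      rw [← hc, AddSubmonoidClass.coe_nsmul, pr_nsmul, hu2 i hi, mul_zero]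
    rw [AddSubmonoid.coe_add, pr_add] at h4
    have := latt_pr c i
    show pr v (b : Fin d → ℤ) i ≤ 0
    linarith
  obtain ⟨c, hc⟩ := core (fun (a : A) j => pr v a.1 j) (fun (b : B) j => pr v b.1 j)
    (fun a j => (mem_dual v a.1).1 (hAl a.1 a.2) j) hA0 hB0 hray
  refine ⟨c, ?_⟩
  have h := hc.comp (tendsto_pow_atTop_atTop_of_one_lt hp.one_lt)
  refine h.congr fun e => ?_
  simp only [Function.comp_apply, nuF]
  rw [nu_set hp hAl hBl e]
  push_cast
  rfl


end Paper
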